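/- Let −1/2 < α < 0, let n ∈ ℤ⁺ be even, let x_{n,0}^{(α)} < ⋯ < x_{n,n}^{(α)} be the Gegenbauer–Gauss points with Lagrange basis polynomials ℒ_{n,i}^{(α)}, and set p_{B,j,i} = ∫_{−1}^{x_{n,j}^{(α)}} ℒ_{n,i}^{(α)}(x) dx. If f ∈ C^{n+1}[−1, 1] with ‖f^{(n+1)}‖_{L^∞[−1,1]} ≤ A for some A > 0, then for every j ∈ {0, …, n}: |∫_{−1}^{x_{n,j}^{(α)}} f(x) dx − Σ_{i=0}^{n} p_{B,j,i} f(x_{n,i}^{(α)})| < A · 2^{−n} · (x_{n,j}^{(α)} + 1) · Γ(α + 1) / (√((n + 1)(2α + n + 1)) · Γ(n + α + 1)) · C(n/2 + α, n/2), where C(a, b) = Γ(a + 1) / (Γ(b + 1) Γ(a − b + 1)) is the generalized binomial coefficient. -/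

import Mathlib

/-- The generalized binomial coefficient `C(a, b) = Γ(a+1) / (Γ(b+1) Γ(a-b+1))`. -/
noncomputable def genBinom (a b : ℝ) : ℝ :=
  Real.Gamma (a + 1) / (Real.Gamma (b + 1) * Real.Gamma (a - b + 1))

open Polynomial Set

/-- Iterated Rolle theorem: if `F 0` vanishes at `m + 1` points and `F (i + 1)` is the derivative of
`F i` for `i < m`, then `F m` has a zero. -/
lemma exists_zero_of_iterated_rolle {a b : ℝ} (m : ℕ) (F : ℕ → ℝ → ℝ)
    (hcont : ∀ i < m, ContinuousOn (F i) (Icc a b))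
    (hderiv : ∀ i < m, ∀ t ∈ Ioo a b, HasDerivAt (F i) (F (i + 1) t) t)
    (y : Fin (m + 1) → ℝ) (hy : StrictMono y) (hmem : ∀ i, y i ∈ Icc a b)
    (hzero : ∀ i, F 0 (y i) = 0) : ∃ ξ ∈ Icc a b, F m ξ = 0 := by
  induction m generalizing F with
  | zero => exact ⟨y 0, hmem 0, hzero 0⟩
  | succ m ih =>
    have hrolle (i : Fin (m + 1)) :
        ∃ z ∈ Ioo (y i.castSucc) (y i.succ), F 1 z = 0 := by
      refine exists_hasDerivAt_eq_zero (hy i.castSucc_lt_succ)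
        ((hcont 0 m.succ_pos).mono (Icc_subset_Icc (hmem _).1 (hmem _).2))
        (by rw [hzero, hzero]) fun t ht => hderiv 0 m.succ_pos t ?_
      exact ⟨(hmem _).1.trans_lt ht.1, ht.2.trans_le (hmem _).2⟩
    choose z hz hz0 using hrolle
    refine ih (fun i => F (i + 1)) (fun i hi => hcont _ (by omega))
      (fun i hi => hderiv _ (by omega)) z ?_ ?_ hz0
    · refine Fin.strictMono_iff_lt_succ.2 ?_
      intro i
      obtain _ | m := m
      · exact i.elim0
      · have := (hz i.castSucc).2
        rw [Fin.succ_castSucc] at this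
        exact this.trans (hz i.succ).1
    · exact fun i => ⟨(hmem _).1.trans (hz i).1.le, (hz i).2.le.trans (hmem _).2⟩

/-- If a function agrees with a polynomial of degree at most `N` at `N + 1` points, then its
`N`-th derivative equals that of the polynomial somewhere. -/
lemma exists_iteratedDerivWithin_eq_factorial_mul_coeff {a b : ℝ} (hab : a < b) {N : ℕ}
    {f : ℝ → ℝ} (hf : ContDiffOn ℝ N f (Icc a b)) {q : ℝ[X]} (hq : q.natDegree ≤ N)
    (S : Finset ℝ) (hS : S.card = N + 1) (hmem : ∀ t ∈ S, t ∈ Icc a b)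
    (heq : ∀ t ∈ S, f t = q.eval t) :
    ∃ ξ ∈ Icc a b, iteratedDerivWithin N f (Icc a b) ξ = N.factorial * q.coeff N := by
  have hu := uniqueDiffOn_Icc hab
  obtain ⟨ξ, hξ, h0⟩ := exists_zero_of_iterated_rolle (a := a) (b := b) N
    (fun i t => iteratedDerivWithin i f (Icc a b) t - (derivative^[i] q).eval t)
    (fun i hi => (hf.continuousOn_iteratedDerivWithin (by exact_mod_cast hi.le) hu).sub
      (Polynomial.continuousOn _))
    (fun i hi t ht => by
      have hd := (hf.differentiableOn_iteratedDerivWithin (m := i) (by exact_mod_cast hi) hu) t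
        (Ioo_subset_Icc_self ht)
      have h1 := hd.hasDerivWithinAt
      rw [← iteratedDerivWithin_succ] at h1
      have h2 := (derivative^[i] q).hasDerivAt t
      rw [← Function.iterate_succ_apply' (⇑derivative)] at h2
      exact (h1.hasDerivAt (Icc_mem_nhds ht.1 ht.2)).sub h2)
    (S.orderEmbOfFin hS) (OrderEmbedding.strictMono _)
    (fun i => hmem _ (S.orderEmbOfFin_mem hS i))
    (fun i => by simp [heq _ (S.orderEmbOfFin_mem hS i)])
  refine ⟨ξ, hξ, ?_⟩
  have hc : derivative^[N] q = C ((N.factorial : ℝ) * q.coeff N) := by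
    have hdeg : (derivative^[N] q).natDegree = 0 := by
      have := natDegree_iterate_derivative q N
      omega
    rw [eq_C_of_natDegree_eq_zero hdeg, coeff_iterate_derivative]
    simp [Nat.descFactorial_self]
  rw [sub_eq_zero] at h0
  rw [h0, hc, eval_C]

/-- Pointwise error bound for Lagrange interpolation. -/
lemma abs_sub_eval_le_of_interpolates {a b : ℝ} (hab : a < b) {N : ℕ} {f : ℝ → ℝ}
    (hf : ContDiffOn ℝ N f (Icc a b)) {A : ℝ}
    (hA : ∀ t ∈ Icc a b, |iteratedDerivWithin N f (Icc a b) t| ≤ A)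
    {x : Fin N → ℝ} (hx : Function.Injective x) (hmem : ∀ i, x i ∈ Icc a b)
    {P : ℝ[X]} (hP : P.natDegree < N) (hPx : ∀ i, P.eval (x i) = f (x i))
    {t : ℝ} (ht : t ∈ Icc a b) :
    |f t - P.eval t| ≤ A / N.factorial * |(Lagrange.nodal Finset.univ x).eval t| := by
  set p := Lagrange.nodal Finset.univ x with hp
  have hpdeg : p.natDegree = N := by simp [hp, Lagrange.natDegree_nodal]
  have hpx (i) : p.eval (x i) = 0 := Lagrange.eval_nodal_at_node (Finset.mem_univ i)
  by_cases hxt : ∃ i, t = x i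
  · obtain ⟨i, rfl⟩ := hxt
    simp [hPx, hpx]
  push Not at hxt
  have hpt : p.eval t ≠ 0 := by
    rw [hp, Lagrange.eval_nodal, Finset.prod_ne_zero_iff]
    exact fun i _ => sub_ne_zero.2 (hxt i)
  set c := (f t - P.eval t) / p.eval t with hc
  obtain ⟨ξ, hξ, h⟩ := exists_iteratedDerivWithin_eq_factorial_mul_coeff hab hf (q := P + C c * p)
    (natDegree_add_le_of_degree_le hP.le ((natDegree_C_mul_le _ _).trans hpdeg.le))
    (insert t (Finset.univ.image x))
    (by
      rw [Finset.card_insert_of_notMem (by simpa [eq_comm] using hxt),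
        Finset.card_image_of_injective _ hx, Finset.card_fin])
    (by simpa using ⟨ht, hmem⟩)
    (by
      simp only [Finset.mem_insert, Finset.mem_image, Finset.mem_univ, true_and]
      rintro s (rfl | ⟨i, rfl⟩)
      · simp [hc, hpt]
      · simp [hPx, hpx])
  have hcoeff : (P + C c * p).coeff N = c := by
    have h1 : p.coeff N = 1 := by
      have := (Lagrange.nodal_monic (s := Finset.univ) (v := x)).coeff_natDegree
      rwa [← hp, hpdeg] at this
    simp [coeff_eq_zero_of_natDegree_lt hP, h1]
  rw [hcoeff] at h
  have hfac : (0 : ℝ) < N.factorial := by positivity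
  have hcA : |c| ≤ A / N.factorial := by
    rw [le_div_iff₀ hfac, mul_comm, ← abs_of_pos hfac, ← abs_mul, ← h]
    exact hA ξ hξ
  have : f t - P.eval t = c * p.eval t := by rw [hc, div_mul_cancel₀ _ hpt]
  rw [this, abs_mul]
  gcongr

/-- Derivative formula for standardized Gegenbauer polynomials. -/
lemma gegenbauer_derivative {α : ℝ} (hα : -1/2 < α) {G : ℕ → ℝ[X]}
    (hG0 : G 0 = 1) (hG1 : G 1 = X)
    (hGrec : ∀ k : ℕ, 1 ≤ k →
      C ((k : ℝ) + 2 * α) * G (k + 1) =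
        C (2 * ((k : ℝ) + α)) * (X * G k) - C (k : ℝ) * G (k - 1)) (k : ℕ) :
    (1 - X ^ 2) * derivative (G k) = C ((k : ℝ) + 2 * α) * (X * G k - G (k + 1)) := by
  induction k using Nat.twoStepInduction with
  | zero => simp [hG0, hG1]
  | one =>
    have h := hGrec 1 le_rfl
    simp only [hG0, hG1, Nat.cast_one, Nat.sub_self, map_mul, map_add, map_one,
      map_ofNat] at h ⊢
    rw [derivative_X]
    linear_combination h
  | more k ih0 ih1 =>
    have h1 := hGrec (k + 1) (by omega)
    have h2 := hGrec (k + 2) (by omega)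
    have hd := congrArg derivative h1
    simp only [Nat.add_sub_cancel, show k + 2 - 1 = k + 1 by omega] at h1 h2 hd
    simp only [derivative_mul, derivative_sub, derivative_C, derivative_X] at hd
    have hne : C (((k + 1 : ℕ) : ℝ) + 2 * α) ≠ 0 := by
      rw [Ne, C_eq_zero]
      have : (0 : ℝ) ≤ k := k.cast_nonneg
      push_cast
      linarith
    refine mul_left_cancel₀ hne ?_
    simp only [map_mul, map_add, map_ofNat, map_natCast, map_one, Nat.cast_add, Nat.cast_ofNat,
      Nat.cast_one] at *
    linear_combination (1 - X ^ 2) * hd + 2 * ((k : ℝ[X]) + 1 + C α) * X * ih1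
      - ((k : ℝ[X]) + 1) * ih0 + ((k : ℝ[X]) + 1 + 2 * C α) * h2 - (k + 2 * C α) * X * h1

/-- The Gegenbauer differential equation. -/
lemma gegenbauer_differential_equation {α : ℝ} (hα : -1/2 < α) {G : ℕ → ℝ[X]}
    (hG0 : G 0 = 1) (hG1 : G 1 = X)
    (hGrec : ∀ k : ℕ, 1 ≤ k →
      C ((k : ℝ) + 2 * α) * G (k + 1) =
        C (2 * ((k : ℝ) + α)) * (X * G k) - C (k : ℝ) * G (k - 1)) (k : ℕ) :
    (1 - X ^ 2) * derivative (derivative (G (k + 1))) =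
      C (2 * α + 1) * (X * derivative (G (k + 1))) -
        C (((k + 1 : ℕ) : ℝ) * ((k + 1 : ℕ) + 2 * α)) * G (k + 1) := by
  have h0 := gegenbauer_derivative hα hG0 hG1 hGrec k
  have h1 := gegenbauer_derivative hα hG0 hG1 hGrec (k + 1)
  have hr := hGrec (k + 1) (by omega)
  rw [Nat.add_sub_cancel] at hr
  have hA : (1 - X ^ 2) * derivative (G (k + 1)) =
      C ((k + 1 : ℕ) : ℝ) * (G k - X * G (k + 1)) := by
    simp only [map_mul, map_add, map_ofNat, map_natCast] at *
    linear_combination h1 - hr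
  have hd := congrArg derivative hA
  simp only [derivative_mul, derivative_sub, derivative_C, derivative_X, derivative_one,
    derivative_X_pow] at hd
  have hne : (1 - X ^ 2 : ℝ[X]) ≠ 0 := by
    intro h
    simpa using congrArg (eval 0) h
  refine mul_left_cancel₀ hne ?_
  simp only [map_mul, map_add, map_ofNat, map_natCast, map_one, Nat.cast_add, Nat.cast_ofNat,
      Nat.cast_one] at *
  linear_combination (1 - X ^ 2) * hd + ((k : ℝ[X]) + 1) * h0 - (k + 2 * C α) * X * hA

lemma gegenbauer_natDegree_le {α : ℝ} (hα : -1/2 < α) {G : ℕ → ℝ[X]}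
    (hG0 : G 0 = 1) (hG1 : G 1 = X)
    (hGrec : ∀ k : ℕ, 1 ≤ k →
      C ((k : ℝ) + 2 * α) * G (k + 1) =
        C (2 * ((k : ℝ) + α)) * (X * G k) - C (k : ℝ) * G (k - 1)) (k : ℕ) :
    (G k).natDegree ≤ k := by
  induction k using Nat.twoStepInduction with
  | zero => simp [hG0]
  | one => simp [hG1]
  | more k ih0 ih1 =>
    have h := congrArg natDegree (hGrec (k + 1) (by omega))
    rw [natDegree_C_mul (by have : (0 : ℝ) ≤ k := k.cast_nonneg
                            push_cast
                            linarith), Nat.add_sub_cancel] at h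
    rw [h]
    refine natDegree_sub_le_of_le ((natDegree_C_mul_le _ _).trans ?_)
      ((natDegree_C_mul_le _ _).trans (by omega)) |>.trans (max_self _).le
    exact natDegree_mul_le.trans (by rw [natDegree_X]; omega)

lemma gegenbauer_odd_eval_zero {α : ℝ} (hα : -1/2 < α) {G : ℕ → ℝ[X]} (hG1 : G 1 = X)
    (hGrec : ∀ k : ℕ, 1 ≤ k →
      C ((k : ℝ) + 2 * α) * G (k + 1) =
        C (2 * ((k : ℝ) + α)) * (X * G k) - C (k : ℝ) * G (k - 1)) (m : ℕ) :
    (G (2 * m + 1)).eval 0 = 0 := by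
  induction m with
  | zero => simp [hG1]
  | succ m ih =>
    have h := congrArg (eval 0) (hGrec (2 * m + 2) (by omega))
    rw [show 2 * m + 2 - 1 = 2 * m + 1 by omega] at h
    simp only [eval_mul, eval_sub, eval_C, eval_X, ih, zero_mul, mul_zero, sub_zero] at h
    refine (mul_eq_zero.1 h).resolve_left ?_
    have : (0 : ℝ) ≤ m := m.cast_nonneg
    push_cast
    linarith

/-- The linear coefficient of a monic odd-degree solution of the Gegenbauer equation. -/
lemma gegenbauer_equation_coeff_one {α : ℝ} (hα : -1/2 < α) {m : ℕ} {p : ℝ[X]}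
    (hlead : p.coeff (2 * m + 1) = 1)
    (hode : (1 - X ^ 2) * derivative (derivative p) =
      C (2 * α + 1) * (X * derivative p) -
        C (((2 * m + 1 : ℕ) : ℝ) * ((2 * m + 1 : ℕ) + 2 * α)) * p) :
    ((2 * m + 1).factorial : ℝ) * Real.Gamma (m + 1 + α) =
      (-4) ^ m * m.factorial * Real.Gamma (2 * m + 1 + α) * p.coeff 1 := by
  have hrec (j : ℕ) : ((j : ℝ) + 2) * (j + 1) * p.coeff (j + 2) =
      -((2 * m + 1 - j) * (2 * m + 1 + j + 2 * α)) * p.coeff j := by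
    have h := congrArg (coeff · j) hode
    simp only [sub_mul, one_mul, coeff_sub, coeff_C_mul, mul_assoc] at h
    obtain _ | _ | j := j
    · simp [coeff_derivative] at h ⊢
      linear_combination h
    · simp [coeff_X_mul, coeff_derivative, coeff_X_pow_mul'] at h ⊢
      linear_combination h
    · simp [coeff_X_mul, coeff_derivative, coeff_X_pow_mul'] at h ⊢
      linear_combination h
  have key (i : ℕ) (hi : i ≤ m) :
      ((2 * i + 1).factorial : ℝ) * Real.Gamma (m + 1 + α) * (m - i).factorial *
        p.coeff (2 * i + 1) =
      (-4) ^ i * m.factorial * Real.Gamma (m + i + 1 + α) * p.coeff 1 := by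
    induction i with
    | zero =>
      simp only [Nat.sub_zero, mul_zero, zero_add, Nat.factorial_one, Nat.cast_one, one_mul,
        pow_zero, Nat.cast_zero, add_zero]
      ring
    | succ i ih =>
      obtain ⟨d, rfl⟩ := Nat.exists_eq_add_of_le hi
      have ih := ih (by omega)
      have h := hrec (2 * i + 1)
      rw [show i + 1 + d - i = d + 1 by omega] at ih
      rw [show i + 1 + d - (i + 1) = d by omega]
      have hG : Real.Gamma (((i + 1 + d : ℕ) : ℝ) + (i + 1 : ℕ) + 1 + α) =
          (((i + 1 + d : ℕ) : ℝ) + i + 1 + α) *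
            Real.Gamma (((i + 1 + d : ℕ) : ℝ) + i + 1 + α) := by
        rw [← Real.Gamma_add_one]
        · push_cast; ring_nf
        · have : (0 : ℝ) ≤ i := i.cast_nonneg
          have : (0 : ℝ) ≤ d := d.cast_nonneg
          push_cast
          linarith
      rw [hG]
      rw [show 2 * (i + 1) + 1 = 2 * i + 1 + 1 + 1 by ring, Nat.factorial_succ (2 * i + 1 + 1),
        Nat.factorial_succ (2 * i + 1)]
      rw [Nat.factorial_succ d] at ih
      set g := Real.Gamma (((i + 1 + d : ℕ) : ℝ) + i + 1 + α)
      push_cast at h ih ⊢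
      have hd : (d : ℝ) + 1 ≠ 0 := by positivity
      generalize Real.Gamma ((i : ℝ) + 1 + d + 1 + α) = g' at *
      refine mul_left_cancel₀ hd ?_
      linear_combination ((2 * i + 1).factorial : ℝ) * g' * d.factorial * (d + 1) * h
        - 4 * (d + 1) * (i + 1 + d + i + 1 + α) * ih
  have h := key m le_rfl
  rw [hlead] at h
  simp only [Nat.sub_self, Nat.factorial_zero, Nat.cast_one, mul_one] at h
  rw [h]
  congr 3
  ring

/-- Sonin-type bound for solutions of the Gegenbauer equation with `α ≤ 0` vanishing at `0`. -/
lemma gegenbauer_equation_eval_sq_le {α ν : ℝ} (hα : α ≤ 0) (hν : 0 < ν) {p : ℝ[X]}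
    (hode : (1 - X ^ 2) * derivative (derivative p) =
      C (2 * α + 1) * (X * derivative p) - C ν * p)
    (h0 : p.eval 0 = 0) {t : ℝ} (ht : t ∈ Icc (-1 : ℝ) 1) :
    p.eval t ^ 2 ≤ p.coeff 1 ^ 2 / ν := by
  set h : ℝ[X] := C ν * p ^ 2 + (1 - X ^ 2) * derivative p ^ 2 with hh
  have hd : derivative h = C (4 * α) * X * derivative p ^ 2 := by
    have := congrArg (2 * derivative p * ·) hode
    simp only [hh, derivative_mul, derivative_sub, derivative_C, derivative_one,
      derivative_X, derivative_pow, map_mul, map_add, map_ofNat, map_natCast, map_one] at *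
    push_cast at *
    linear_combination this
  have hde (s : ℝ) : deriv (fun u => h.eval u) s = 4 * α * s * (derivative p).eval s ^ 2 := by
    rw [Polynomial.deriv, hd]
    simp
  have hle : h.eval t ≤ h.eval 0 := by
    rcases le_total 0 t with h0t | ht0
    · refine antitoneOn_of_deriv_nonpos (convex_Ici (0 : ℝ)) h.continuousOn
        h.differentiable.differentiableOn (fun s hs => ?_) self_mem_Ici h0t h0t
      rw [interior_Ici] at hs
      rw [hde]
      exact mul_nonpos_of_nonpos_of_nonneg
        (mul_nonpos_of_nonpos_of_nonneg (by linarith) (le_of_lt hs)) (sq_nonneg _)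
    · refine monotoneOn_of_deriv_nonneg (convex_Iic (0 : ℝ)) h.continuousOn
        h.differentiable.differentiableOn (fun s hs => ?_) ht0 self_mem_Iic ht0
      rw [interior_Iic] at hs
      rw [hde]
      exact mul_nonneg (mul_nonneg_of_nonpos_of_nonpos (by linarith) (le_of_lt hs)) (sq_nonneg _)
  have hp1 : (derivative p).eval 0 = p.coeff 1 := by
    rw [← coeff_zero_eq_eval_zero, coeff_derivative]
    simp
  have ht2 : 0 ≤ (1 - t ^ 2) * (derivative p).eval t ^ 2 :=
    mul_nonneg (by nlinarith [ht.1, ht.2]) (sq_nonneg _)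
  simp only [hh, eval_add, eval_mul, eval_C, eval_pow, h0, ne_eq, OfNat.ofNat_ne_zero,
    not_false_eq_true, zero_pow, mul_zero, eval_sub, eval_one, eval_X, sub_zero, hp1, one_mul,
    zero_add] at hle
  rw [le_div_iff₀ hν]
  linarith

/-- The nodal polynomial of the zeros of `G (2m + 1)`, for `-1/2 < α ≤ 0`, is bounded on `[-1, 1]`
by the value of its Sonin majorant at the origin. -/
lemma abs_eval_nodal_gegenbauer_le {α : ℝ} (hα1 : -1/2 < α) (hα2 : α ≤ 0) {n m : ℕ}
    (hn : n = 2 * m) {G : ℕ → ℝ[X]} (hG0 : G 0 = 1) (hG1 : G 1 = X)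
    (hGrec : ∀ k : ℕ, 1 ≤ k →
      C ((k : ℝ) + 2 * α) * G (k + 1) =
        C (2 * ((k : ℝ) + α)) * (X * G k) - C (k : ℝ) * G (k - 1))
    {x : Fin (n + 1) → ℝ} (hx_inj : Function.Injective x) (hx_mem : ∀ i, x i ∈ Ioo (-1 : ℝ) 1)
    (hx_root : ∀ y : ℝ, (G (n + 1)).eval y = 0 ↔ ∃ i, y = x i)
    {t : ℝ} (ht : t ∈ Icc (-1 : ℝ) 1) :
    |(Lagrange.nodal Finset.univ x).eval t| ≤
      (2 * m + 1).factorial * Real.Gamma (m + 1 + α) /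
        (4 ^ m * m.factorial * Real.Gamma (2 * m + 1 + α) *
          √((2 * m + 1) * (2 * m + 1 + 2 * α))) := by
  have hm0 : (0 : ℝ) ≤ m := m.cast_nonneg
  subst hn
  set p := Lagrange.nodal Finset.univ x with hp
  have hpmonic : p.Monic := Lagrange.nodal_monic
  have hpdeg : p.natDegree = 2 * m + 1 := by simp [hp, Lagrange.natDegree_nodal]
  -- The nodal polynomial is a scalar multiple of `G (2 * m + 1)`
  have hGne : G (2 * m + 1) ≠ 0 := by
    intro h
    obtain ⟨i, hi⟩ := (hx_root 1).1 (by rw [h, eval_zero])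
    exact (hx_mem i).2.ne hi.symm
  have hdvd : p ∣ G (2 * m + 1) := by
    refine Finset.prod_dvd_of_coprime
      (fun i _ k _ hik => pairwise_coprime_X_sub_C hx_inj hik) fun i _ => ?_
    exact dvd_iff_isRoot.2 ((hx_root _).2 ⟨i, rfl⟩)
  obtain ⟨r, hr⟩ := hdvd
  have hr0 : r ≠ 0 := by
    rintro rfl
    simp [hGne] at hr
  have hrdeg : r.natDegree = 0 := by
    have h1 := gegenbauer_natDegree_le hα1 hG0 hG1 hGrec (2 * m + 1)
    rw [hr, hpmonic.natDegree_mul' hr0, hpdeg] at h1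
    omega
  obtain ⟨c, hrc⟩ : ∃ c, r = C c := ⟨_, eq_C_of_natDegree_eq_zero hrdeg⟩
  rw [hrc] at hr hr0
  have hc : c ≠ 0 := by simpa using hr0
  have hode : (1 - X ^ 2) * derivative (derivative p) =
      C (2 * α + 1) * (X * derivative p) -
        C (((2 * m + 1 : ℕ) : ℝ) * ((2 * m + 1 : ℕ) + 2 * α)) * p := by
    have h := gegenbauer_differential_equation hα1 hG0 hG1 hGrec (2 * m)
    rw [hr] at h
    simp only [derivative_mul, derivative_C, mul_zero, add_zero] at h
    refine mul_right_cancel₀ hr0 ?_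
    linear_combination h
  have hp0 : p.eval 0 = 0 := by
    have h := gegenbauer_odd_eval_zero hα1 hG1 hGrec m
    rw [hr, eval_mul, eval_C] at h
    exact (mul_eq_zero.1 h).resolve_right hc
  have hlead : p.coeff (2 * m + 1) = 1 := by
    rw [← hpdeg]
    exact hpmonic
  have hcoeff := gegenbauer_equation_coeff_one hα1 hlead hode
  set ν : ℝ := ((2 * m + 1 : ℕ) : ℝ) * ((2 * m + 1 : ℕ) + 2 * α) with hν
  have hνpos : 0 < ν := by
    rw [hν]
    push_cast
    exact mul_pos (by linarith) (by linarith)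
  have hΓ1 : 0 < Real.Gamma (2 * m + 1 + α) := Real.Gamma_pos_of_pos (by linarith)
  have hΓ2 : 0 < Real.Gamma (m + 1 + α) := Real.Gamma_pos_of_pos (by linarith)
  have habs : ((2 * m + 1).factorial : ℝ) * Real.Gamma (m + 1 + α) =
      4 ^ m * m.factorial * Real.Gamma (2 * m + 1 + α) * |p.coeff 1| := by
    have h := congrArg abs hcoeff
    simpa [abs_mul, abs_of_pos hΓ1, abs_of_pos hΓ2] using h
  have hν' : (2 * m + 1 : ℝ) * (2 * m + 1 + 2 * α) = ν := by
    rw [hν]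
    push_cast
    ring
  have hK : (4 : ℝ) ^ m * m.factorial * Real.Gamma (2 * m + 1 + α) ≠ 0 := by positivity
  rw [hν', habs, mul_div_mul_left _ _ hK]
  refine abs_le_of_sq_le_sq ?_ (div_nonneg (abs_nonneg _) (Real.sqrt_nonneg _))
  rw [div_pow, sq_abs, Real.sq_sqrt hνpos.le]
  exact gegenbauer_equation_eval_sq_le hα2 hνpos hode hp0 ht

/-- **Error bound for the barycentric Gegenbauer quadrature, case `-1/2 < α < 0`, `n` even.**
With Gegenbauer–Gauss points `x 0 < ⋯ < x n`, Lagrange basis polynomials `L i`,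
`p_{B,j,i} = ∫_{-1}^{x j} (L i)(t) dt`, and `f ∈ C^{n+1}[-1,1]` with
`‖f^{(n+1)}‖_∞ ≤ A`, for every `j`:
`|∫_{-1}^{x j} f - ∑ i, p_{B,j,i} f(x i)|
   < A 2^{-n} (x j + 1) Γ(α+1) / (√((n+1)(2α+n+1)) Γ(n+α+1)) · C(n/2 + α, n/2)`. -/
theorem barycentric_gegenbauer_quadrature_bound_neg_alpha_even
    (α : ℝ) (hα1 : -1/2 < α) (hα2 : α < 0) (n : ℕ) (hn : 1 ≤ n) (heven : Even n)
    (G : ℕ → Polynomial ℝ)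
    (hG0 : G 0 = 1) (hG1 : G 1 = Polynomial.X)
    (hGrec : ∀ k : ℕ, 1 ≤ k →
      Polynomial.C ((k : ℝ) + 2 * α) * G (k + 1) =
        Polynomial.C (2 * ((k : ℝ) + α)) * (Polynomial.X * G k) -
          Polynomial.C (k : ℝ) * G (k - 1))
    (x : Fin (n + 1) → ℝ)
    (hx_mono : StrictMono x)
    (hx_mem : ∀ i, x i ∈ Set.Ioo (-1 : ℝ) 1)
    (hx_root : ∀ y : ℝ, (G (n + 1)).eval y = 0 ↔ ∃ i, y = x i)
    (L : Fin (n + 1) → Polynomial ℝ)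
    (hL_deg : ∀ k, (L k).natDegree ≤ n)
    (hL_eval : ∀ k j, (L k).eval (x j) = if j = k then (1 : ℝ) else 0)
    (f : ℝ → ℝ)
    (hf : ContDiffOn ℝ (n + 1 : ℕ) f (Set.Icc (-1 : ℝ) 1))
    (A : ℝ) (hA : 0 < A)
    (hbound : ∀ t ∈ Set.Icc (-1 : ℝ) 1,
      |iteratedDerivWithin (n + 1) f (Set.Icc (-1 : ℝ) 1) t| ≤ A) :
    ∀ j : Fin (n + 1),
      |(∫ t in (-1 : ℝ)..(x j), f t) -
          ∑ i : Fin (n + 1), (∫ t in (-1 : ℝ)..(x j), (L i).eval t) * f (x i)| <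
        A * (2 : ℝ) ^ (-(n : ℤ)) * (x j + 1) * Real.Gamma (α + 1) /
            (Real.sqrt (((n : ℝ) + 1) * (2 * α + (n : ℝ) + 1)) *
              Real.Gamma ((n : ℝ) + α + 1)) *
          genBinom ((n : ℝ) / 2 + α) ((n : ℝ) / 2) := by
  intro j
  obtain ⟨m, hm⟩ := heven
  rw [← two_mul] at hm
  have hm0 : (0 : ℝ) ≤ m := m.cast_nonneg
  have hIcc (i) : x i ∈ Icc (-1 : ℝ) 1 := Ioo_subset_Icc_self (hx_mem i)
  have hΓ1 : 0 < Real.Gamma (2 * m + 1 + α) := Real.Gamma_pos_of_pos (by linarith)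
  have hΓ2 : 0 < Real.Gamma (m + 1 + α) := Real.Gamma_pos_of_pos (by linarith)
  have hΓ3 : 0 < Real.Gamma (α + 1) := Real.Gamma_pos_of_pos (by linarith)
  have hsq : 0 < √((2 * m + 1 : ℝ) * (2 * m + 1 + 2 * α)) :=
    Real.sqrt_pos.2 (mul_pos (by linarith) (by linarith))
  have hpM (t : ℝ) (ht : t ∈ Icc (-1 : ℝ) 1) :=
    abs_eval_nodal_gegenbauer_le hα1 hα2.le hm hG0 hG1 hGrec hx_mono.injective hx_mem hx_root ht
  set M : ℝ := (2 * m + 1).factorial * Real.Gamma (m + 1 + α) /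
    (4 ^ m * m.factorial * Real.Gamma (2 * m + 1 + α) *
      √((2 * m + 1) * (2 * m + 1 + 2 * α))) with hM
  have hMpos : 0 < M := by positivity
  set P : ℝ[X] := ∑ i, C (f (x i)) * L i with hP
  have hPdeg : P.natDegree < n + 1 := by
    refine Nat.lt_succ_of_le (natDegree_sum_le_of_forall_le _ _ fun i _ => ?_)
    exact (natDegree_C_mul_le _ _).trans (hL_deg i)
  have hPx (i) : P.eval (x i) = f (x i) := by
    simp [hP, eval_finsetSum, hL_eval]
  have herr (t : ℝ) (ht : t ∈ Icc (-1 : ℝ) 1) :=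
    abs_sub_eval_le_of_interpolates (by norm_num) hf hbound hx_mono.injective hIcc hPdeg hPx ht
  have hj := hx_mem j
  have hsub : Icc (-1 : ℝ) (x j) ⊆ Icc (-1 : ℝ) 1 := Icc_subset_Icc_right hj.2.le
  have hfc : ContinuousOn f (Icc (-1 : ℝ) (x j)) := hf.continuousOn.mono hsub
  have hsum : ∑ i : Fin (n + 1), (∫ t in (-1 : ℝ)..(x j), (L i).eval t) * f (x i) =
      ∫ t in (-1 : ℝ)..(x j), P.eval t := by
    simp only [hP, eval_finsetSum, eval_mul, eval_C]
    rw [intervalIntegral.integral_finsetSum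
      fun i _ => ((L i).continuous.const_mul (f (x i))).intervalIntegrable _ _]
    exact Finset.sum_congr rfl fun i _ => by
      rw [intervalIntegral.integral_const_mul, mul_comm]
  rw [hsum, ← intervalIntegral.integral_sub (hfc.intervalIntegrable_of_Icc hj.1.le)
    (P.continuous.intervalIntegrable _ _)]
  have hAN : 0 < A / (n + 1).factorial := by positivity
  calc |∫ t in (-1 : ℝ)..(x j), (f t - P.eval t)|
      ≤ ∫ t in (-1 : ℝ)..(x j), |f t - P.eval t| :=
        intervalIntegral.abs_integral_le_integral_abs hj.1.le
    _ < ∫ _ in (-1 : ℝ)..(x j), A / (n + 1).factorial * M := by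
        refine intervalIntegral.integral_lt_integral_of_continuousOn_of_le_of_exists_lt hj.1
          (hfc.sub P.continuousOn).abs continuousOn_const (fun t ht => ?_)
          ⟨x j, right_mem_Icc.2 hj.1.le, ?_⟩
        · have ht' := hsub (Ioc_subset_Icc_self ht)
          exact (herr t ht').trans (mul_le_mul_of_nonneg_left (hpM t ht') hAN.le)
        · rw [hPx, sub_self, abs_zero]
          exact mul_pos hAN hMpos
    _ = _ := ?_
  rw [intervalIntegral.integral_const, smul_eq_mul, sub_neg_eq_add, hM, genBinom]
  have e1 : ((n : ℝ) + 1) * (2 * α + n + 1) = (2 * m + 1) * (2 * m + 1 + 2 * α) := by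
    rw [hm]; push_cast; ring
  have e2 : (n : ℝ) + α + 1 = 2 * m + 1 + α := by rw [hm]; push_cast; ring
  have e3 : (n : ℝ) / 2 = m := by rw [hm]; push_cast; ring
  have e4 : (m : ℝ) + α + 1 = m + 1 + α := by ring
  have e5 : (m : ℝ) + α - m + 1 = α + 1 := by ring
  have e6 : (2 : ℝ) ^ (-(n : ℤ)) = (4 ^ m)⁻¹ := by
    rw [zpow_neg, zpow_natCast, hm, pow_mul]; norm_num
  rw [e1, e2, e3, e4, e5, e6, Real.Gamma_nat_eq_factorial, hm]
  field_simp
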